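/- Let μ = ½(δ₁ + δ₋₁) on ℝ, so that its characteristic function is μ̂(y) = cos y. If m, n are coprime positive integers and there exists a probability measure ν on ℝ with (ν̂(y))ⁿ = (cos y)ᵐ for all y ∈ ℝ, then m ≥ n. (The algebraic divisibility set of μ satisfies Λ^alg(μ) ⊆ ℚ ∩ [1,∞), and this bound is sharp since 1 ∈ Λ^alg(μ).) -/

import Mathlib

open MeasureTheory

/-- The characteristic function of a measure on `ℝ`. -/
noncomputable def charFunR (μ : Measure ℝ) (y : ℝ) : ℂ :=
  ∫ x, Complex.exp (Complex.I * y * x) ∂μ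

lemma charFunR_eq_charFun (μ : Measure ℝ) (y : ℝ) : charFunR μ y = charFun μ y := by
  rw [charFun_apply_real, charFunR]
  congr 1 with x
  ring_nf

lemma integrable_exp_mul_I (ν : Measure ℝ) [IsFiniteMeasure ν] (y : ℝ) :
    Integrable (fun x : ℝ ↦ Complex.exp (y * x * Complex.I)) ν := by
  refine Integrable.of_bound (C := 1) (by fun_prop) (ae_of_all _ fun x ↦ ?_)
  rw [← Complex.ofReal_mul, Complex.norm_exp_ofReal_mul_I]

lemma norm_exp_mul_I_sub_one_sq (t : ℝ) :
    ‖Complex.exp (t * Complex.I) - 1‖ ^ 2 = 2 * (1 - (Complex.exp (t * Complex.I)).re) := by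
  rw [← Complex.normSq_eq_norm_sq, Complex.normSq_apply]
  simp only [Complex.sub_re, Complex.sub_im, Complex.exp_ofReal_mul_I_re,
    Complex.exp_ofReal_mul_I_im, Complex.one_re, Complex.one_im]
  linear_combination Real.sin_sq_add_cos_sq t

/-- Krein's inequality for characteristic functions. -/
lemma norm_charFun_add_sub_sq_le (ν : Measure ℝ) [IsProbabilityMeasure ν] (x h : ℝ) :
    ‖charFun ν (x + h) - charFun ν x‖ ^ 2 ≤ 2 * (1 - (charFun ν h).re) := by
  set g : ℝ → ℝ := fun t ↦ ‖Complex.exp (h * t * Complex.I) - 1‖ with hg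
  have hgm : MemLp g 2 ν := by
    refine MemLp.of_bound (by fun_prop) 2 (ae_of_all _ fun t ↦ ?_)
    rw [hg, norm_norm, ← Complex.ofReal_mul]
    refine (norm_sub_le _ _).trans ?_
    rw [Complex.norm_exp_ofReal_mul_I, norm_one]
    norm_num
  have hle : ‖charFun ν (x + h) - charFun ν x‖ ≤ ∫ t, g t ∂ν := by
    rw [charFun_apply_real, charFun_apply_real,
      ← integral_sub (integrable_exp_mul_I ν _) (integrable_exp_mul_I ν _)]
    refine (norm_integral_le_integral_norm _).trans_eq (integral_congr_ae (ae_of_all _ fun t ↦ ?_))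
    have hfac : Complex.exp (((x + h : ℝ) : ℂ) * t * Complex.I) - Complex.exp (x * t * Complex.I) =
        Complex.exp (((x * t : ℝ) : ℂ) * Complex.I) * (Complex.exp (h * t * Complex.I) - 1) := by
      rw [mul_sub, ← Complex.exp_add, mul_one]
      push_cast
      ring_nf
    simp only [hfac, norm_mul, Complex.norm_exp_ofReal_mul_I, one_mul, hg]
  have hsq : ∫ t, g t ^ 2 ∂ν = 2 * (1 - (charFun ν h).re) := by
    have hre : (charFun ν h).re = ∫ t : ℝ, (Complex.exp (h * t * Complex.I)).re ∂ν := by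
      rw [charFun_apply_real]
      exact (integral_re (𝕜 := ℂ) (integrable_exp_mul_I ν h)).symm
    have hpt (t : ℝ) : g t ^ 2 = 2 * (1 - (Complex.exp (h * t * Complex.I)).re) := by
      simpa using norm_exp_mul_I_sub_one_sq (h * t)
    simp_rw [hpt]
    have hint : Integrable (fun t : ℝ ↦ (Complex.exp (h * t * Complex.I)).re) ν :=
      (integrable_exp_mul_I ν h).re
    rw [integral_const_mul, integral_sub (integrable_const _) hint, hre]
    simp
  have hvar := ProbabilityTheory.variance_nonneg g ν
  rw [ProbabilityTheory.variance_eq_sub hgm] at hvar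
  have hpow : ∫ t, (g ^ 2) t ∂ν = ∫ t, g t ^ 2 ∂ν := rfl
  calc ‖charFun ν (x + h) - charFun ν x‖ ^ 2 ≤ (∫ t, g t ∂ν) ^ 2 := by gcongr
    _ ≤ ∫ t, g t ^ 2 ∂ν := by linarith
    _ = _ := hsq

lemma charFunR_symmetric_bernoulli (y : ℝ) :
    charFunR ((2⁻¹ : ENNReal) • (Measure.dirac (1 : ℝ) + Measure.dirac (-1 : ℝ))) y =
      (Real.cos y : ℂ) := by
  rw [charFunR, integral_smul_measure, integral_add_measure (integrable_dirac (by simp))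
    (integrable_dirac (by simp)), integral_dirac, integral_dirac, Complex.ofReal_cos, Complex.cos]
  simp only [ENNReal.toReal_inv, ENNReal.toReal_ofNat, Complex.real_smul]
  push_cast
  ring_nf


lemma eventually_norm_sub_one_le_two_mul {n : ℕ} (hn : 0 < n) :
    ∀ᶠ z : ℂ in nhds 1, ‖z - 1‖ ≤ 2 * ‖z ^ n - 1‖ := by
  have hc : Continuous fun z : ℂ ↦ ‖∑ i ∈ Finset.range n, z ^ i‖ := by fun_prop
  have hn' : (1 : ℝ) ≤ n := by exact_mod_cast hn
  have hlt : (1 / 2 : ℝ) < ‖∑ i ∈ Finset.range n, (1 : ℂ) ^ i‖ := by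
    simp only [one_pow, Finset.sum_const, Finset.card_range, nsmul_eq_mul, mul_one,
      Complex.norm_natCast]
    linarith
  filter_upwards [hc.continuousAt.eventually (lt_mem_nhds hlt)] with z hz
  rw [← geom_sum_mul, norm_mul]
  nlinarith [norm_nonneg (z - 1)]

lemma abs_cos_pow_sub_one_le (m : ℕ) (h : ℝ) : |Real.cos h ^ m - 1| ≤ m * (h ^ 2 / 2) := by
  induction m with
  | zero => simp
  | succ k ih =>
    have hcos : |Real.cos h - 1| ≤ h ^ 2 / 2 := by
      rw [abs_le]
      constructor <;> nlinarith [Real.one_sub_sq_div_two_le_cos (x := h), Real.cos_le_one h]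
    have hsplit : Real.cos h ^ (k + 1) - 1 =
        Real.cos h * (Real.cos h ^ k - 1) + (Real.cos h - 1) := by ring
    have hmul : |Real.cos h * (Real.cos h ^ k - 1)| ≤ |Real.cos h ^ k - 1| := by
      rw [abs_mul]
      exact mul_le_of_le_one_left (abs_nonneg _) (Real.abs_cos_le_one h)
    rw [hsplit]
    push_cast
    linarith [abs_add_le (Real.cos h * (Real.cos h ^ k - 1)) (Real.cos h - 1)]

/-- For `μ = ½(δ₁ + δ₋₁)` on `ℝ` (whose characteristic function is `cos`):
if `m, n` are coprime positive integers and some probability measure `ν`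
satisfies `ν̂ⁿ = μ̂ᵐ`, then `m ≥ n`; i.e. `Λ^alg(μ) ⊆ ℚ ∩ [1, ∞)`. -/
theorem cos_alg_divisibility (μ : Measure ℝ)
    (hμ : μ = (2⁻¹ : ENNReal) • (Measure.dirac (1 : ℝ) + Measure.dirac (-1 : ℝ)))
    (m n : ℕ) (hm : 0 < m) (hn : 0 < n) (hmn : Nat.Coprime m n)
    (ν : Measure ℝ) [IsProbabilityMeasure ν]
    (hν : ∀ y, (charFunR ν y) ^ n = (charFunR μ y) ^ m) :
    n ≤ m := by
  subst hμ
  have hf (y : ℝ) : charFun ν y ^ n = ((Real.cos y ^ m : ℝ) : ℂ) := by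
    rw [← charFunR_eq_charFun, hν, charFunR_symmetric_bernoulli, Complex.ofReal_pow]
  have hnorm (h : ℝ) : ‖charFun ν (Real.pi / 2 + h)‖ ^ n = |Real.sin h| ^ m := by
    rw [← norm_pow, hf, Complex.norm_real, Real.norm_eq_abs, abs_pow, add_comm,
      Real.cos_add_pi_div_two, abs_neg]
  have hzero : charFun ν (Real.pi / 2) = 0 := by
    have := hf (Real.pi / 2)
    rw [Real.cos_pi_div_two, zero_pow hm.ne', Complex.ofReal_zero] at this
    exact pow_eq_zero_iff hn.ne' |>.mp this
  have hclose : ∀ᶠ h : ℝ in nhds 0, ‖charFun ν h - 1‖ ≤ 2 * ‖charFun ν h ^ n - 1‖ := by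
    have hcont : Filter.Tendsto (charFun ν) (nhds 0) (nhds 1) := by
      simpa using (continuous_charFun (μ := ν)).tendsto 0
    exact hcont.eventually (eventually_norm_sub_one_le_two_mul hn)
  -- Krein's inequality at the zero `π / 2` bounds `|sin h|` by a multiple of `|h| ^ (n / m)`.
  have hbound : ∀ᶠ h : ℝ in nhds 0, (|Real.sin h| ^ m) ^ 2 ≤ (2 * m * h ^ 2) ^ n := by
    filter_upwards [hclose] with h hh
    rw [hf, ← Complex.ofReal_one, ← Complex.ofReal_sub, Complex.norm_real, Real.norm_eq_abs] at hh
    have hkrein := norm_charFun_add_sub_sq_le ν (Real.pi / 2) h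
    rw [hzero, sub_zero] at hkrein
    have hre : 1 - (charFun ν h).re ≤ ‖charFun ν h - ((1 : ℝ) : ℂ)‖ := by
      rw [norm_sub_rev]
      simpa using Complex.re_le_norm (((1 : ℝ) : ℂ) - charFun ν h)
    rw [← hnorm, pow_right_comm]
    gcongr
    linarith [abs_cos_pow_sub_one_le m h]
  by_contra! hlt
  have hsmall : ∀ᶠ h : ℝ in nhds 0, (2 * m) ^ n * h ^ 2 < (1 / 4 : ℝ) ^ m := by
    have hc : Continuous fun h : ℝ ↦ (2 * m : ℝ) ^ n * h ^ 2 := by fun_prop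
    exact hc.continuousAt.eventually (gt_mem_nhds (by simp))
  obtain ⟨h, ⟨⟨hb, hs⟩, hone⟩, hpos⟩ :=
    ((((hbound.and hsmall).and (gt_mem_nhds (zero_lt_one (α := ℝ)))).filter_mono
      nhdsWithin_le_nhds).and (self_mem_nhdsWithin (s := Set.Ioi (0 : ℝ)))).exists
  have hsin : h / 2 ≤ |Real.sin h| := by
    have := Real.sin_gt_sub_cube hpos
    refine le_trans ?_ (le_abs_self _)
    nlinarith [pow_le_of_le_one hpos.le hone.le three_ne_zero]
  have hpow : (1 / 4 : ℝ) ^ m * (h ^ 2) ^ m ≤ ((2 * m) ^ n * h ^ 2) * (h ^ 2) ^ m :=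
    calc (1 / 4 : ℝ) ^ m * (h ^ 2) ^ m = ((h / 2) ^ m) ^ 2 := by
          rw [← mul_pow, pow_right_comm]; ring_nf
      _ ≤ (|Real.sin h| ^ m) ^ 2 := by gcongr
      _ ≤ (2 * m * h ^ 2) ^ n := hb
      _ = (2 * m) ^ n * (h ^ 2) ^ n := mul_pow _ _ _
      _ ≤ (2 * m) ^ n * (h ^ 2) ^ (m + 1) := by
          gcongr ?_ * ?_
          exact pow_le_pow_of_le_one (sq_nonneg h) (by nlinarith) hlt
      _ = _ := by ring
  exact absurd (le_of_mul_le_mul_right hpow (by positivity)) (not_le.mpr hs)
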